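/- arXiv:2305.03330 — 3 statements merged into one kernel-verified Lean document; each statement's English description precedes it below -/
import Mathlib

section
/- Assume Assumption (A), det(S Bᵀ) ≠ 0, and that the family of products {det(S[⟨Q⟩,β]) · det(B[⟨Q⟩,β]) : β ⊆ {1,…,M}, #β = Q} is either all nonnegative or all nonpositive. Then F is a local homeomorphism on ℝ^Q; in particular det(DF(x)) ≠ 0 for every x ∈ ℝ^Q. -/
open scoped BigOperators

/-- `ζ_m(x) = exp(-∑_k b_{km} x_k)`. -/
noncomputable def zeta {K M : ℕ} (B : Matrix (Fin K) (Fin M) ℝ)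
    (x : Fin K → ℝ) (m : Fin M) : ℝ :=
  Real.exp (-(∑ k, B k m * x k))

/-- The map `F : ℝ^K → ℝ^Q` (with `Q = K`), `F_q(x) = ln ∑_m s^{[q]}_m ζ_m(x)`. -/
noncomputable def Fmap {K M : ℕ} (S B : Matrix (Fin K) (Fin M) ℝ)
    (x : Fin K → ℝ) : Fin K → ℝ :=
  fun q => Real.log (∑ m, S q m * zeta B x m)

/-- The minor `det(A[α,β])` of a matrix `A`, for index sets `α`, `β` with `#β = #α`
(junk value `0` when the cardinalities differ). -/
noncomputable def minor {q m : ℕ} (A : Matrix (Fin q) (Fin m) ℝ)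
    (α : Finset (Fin q)) (β : Finset (Fin m)) : ℝ :=
  if h : β.card = α.card then
    Matrix.det (Matrix.of fun i j : Fin α.card =>
      A (α.orderIsoOfFin rfl i) (β.orderIsoOfFin h j))
  else 0

/-- The Jacobian matrix of a map `ℝ^K → ℝ^K` at a point, as a `K × K` matrix. -/
noncomputable def jacobian {K : ℕ} (F : (Fin K → ℝ) → (Fin K → ℝ))
    (x : Fin K → ℝ) : Matrix (Fin K) (Fin K) ℝ :=
  LinearMap.toMatrix' (fderiv ℝ F x).toLinearMap


theorem aux_det_mul {K M : ℕ} (A B : Matrix (Fin K) (Fin M) ℝ) :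
    (A * B.transpose).det =
      ∑ f : Fin K → Fin M, (∏ i, B i (f i)) * (A.submatrix id f).det := by
  classical
  rw [← Matrix.det_transpose]
  have h1 : (A * B.transpose).transpose =
      fun j => ∑ m : Fin M, B j m • A.transpose m := by
    ext j i
    simp [Matrix.mul_apply, Finset.sum_apply, mul_comm]
  rw [h1]
  have h2 := (Matrix.detRowAlternating (n := Fin K) (R := ℝ)).toMultilinearMap.map_sum
    (fun (j : Fin K) (m : Fin M) => B j m • A.transpose m)
  refine h2.trans ?_
  refine Finset.sum_congr rfl fun f _ => ?_
  have h3 := (Matrix.detRowAlternating (n := Fin K) (R := ℝ)).toMultilinearMap.map_smul_univ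
    (fun j : Fin K => B j (f j)) (fun j => A.transpose (f j))
  refine h3.trans ?_
  rw [smul_eq_mul]
  congr 1
  rw [← Matrix.det_transpose]
  rfl

theorem aux_perm {K M : ℕ} (A : Matrix (Fin K) (Fin M) ℝ) (f : Fin K → Fin M)
    (σ : Equiv.Perm (Fin K)) :
    (A.submatrix id (f ∘ σ)).det = (Equiv.Perm.sign σ : ℤ) * (A.submatrix id f).det := by
  rw [← Matrix.det_permute' σ]
  rfl

theorem aux_cb {K M : ℕ} (A B : Matrix (Fin K) (Fin M) ℝ) :
    (Nat.factorial K : ℝ) * (A * B.transpose).det =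
      ∑ f : Fin K → Fin M, (A.submatrix id f).det * (B.submatrix id f).det := by
  classical
  have h1 : ∀ σ : Equiv.Perm (Fin K), (A * B.transpose).det =
      ∑ f : Fin K → Fin M, (∏ i, B i (f (σ i))) *
        ((Equiv.Perm.sign σ : ℤ) * (A.submatrix id f).det) := by
    intro σ
    rw [aux_det_mul]
    rw [← Equiv.sum_comp (Equiv.arrowCongr σ.symm (Equiv.refl (Fin M)))]
    refine Finset.sum_congr rfl fun f _ => ?_
    rw [← aux_perm]
    rfl
  have h2 : ∑ σ : Equiv.Perm (Fin K), (A * B.transpose).det =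
      (Nat.factorial K : ℝ) * (A * B.transpose).det := by
    simp [Fintype.card_perm]
  rw [← h2, Finset.sum_congr rfl fun σ _ => h1 σ, Finset.sum_comm]
  refine Finset.sum_congr rfl fun f _ => ?_
  rw [← Matrix.det_transpose (B.submatrix id f), Matrix.det_apply' (B.submatrix id f).transpose, Finset.mul_sum]
  refine Finset.sum_congr rfl fun σ _ => ?_
  simp only [Matrix.transpose_apply, Matrix.submatrix_apply, id]
  ring

theorem aux_minor {K M : ℕ} (f : Fin K → Fin M) (hf : Function.Injective f) :
    ∃ τ : Equiv.Perm (Fin K), ∀ A : Matrix (Fin K) (Fin M) ℝ,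
      minor A Finset.univ (Finset.univ.image f) =
        (Equiv.Perm.sign τ : ℤ) * (A.submatrix id f).det := by
  classical
  have hc : (Finset.univ.image f).card = (Finset.univ : Finset (Fin K)).card :=
    Finset.card_image_of_injective _ hf
  let e : Fin (Finset.univ : Finset (Fin K)).card ≃ Fin K :=
    ((Finset.univ : Finset (Fin K)).orderIsoOfFin rfl).toEquiv.trans
      (Equiv.subtypeUnivEquiv (fun x => Finset.mem_univ x))
  let g : Fin (Finset.univ : Finset (Fin K)).card → Fin M :=
    fun j => ((Finset.univ.image f).orderIsoOfFin hc j : Fin M)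
  have hg : Function.Injective g := fun a b h =>
    ((Finset.univ.image f).orderIsoOfFin hc).injective (Subtype.ext h)
  have hgm : ∀ j, ∃ i, f i = g j := fun j => by
    have := ((Finset.univ.image f).orderIsoOfFin hc j).2
    obtain ⟨i, _, hi⟩ := Finset.mem_image.1 this
    exact ⟨i, hi⟩
  choose s hs using hgm
  have hsi : Function.Injective (s ∘ e.symm) := by
    intro a b h
    apply e.symm.injective
    apply hg
    rw [← hs, ← hs]
    exact congrArg f h
  let τ : Equiv.Perm (Fin K) := Equiv.ofBijective _ (Finite.injective_iff_bijective.1 hsi)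
  refine ⟨τ, fun A => ?_⟩
  rw [← aux_perm, minor, dif_pos hc, ← Matrix.det_submatrix_equiv_self e]
  congr 1
  ext i j
  have : f (τ (e j)) = g j := by
    show f (s (e.symm (e j))) = g j
    rw [Equiv.symm_apply_apply, hs]
  simp only [Matrix.submatrix_apply, Function.comp, this, Matrix.of_apply, id]
  rfl

theorem aux_prod {K M : ℕ} (S B : Matrix (Fin K) (Fin M) ℝ) (f : Fin K → Fin M) :
    (S.submatrix id f).det * (B.submatrix id f).det = 0 ∨
    ∃ β ∈ Finset.powersetCard K (Finset.univ : Finset (Fin M)),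
      (S.submatrix id f).det * (B.submatrix id f).det =
        minor S Finset.univ β * minor B Finset.univ β := by
  classical
  by_cases hf : Function.Injective f
  · right
    obtain ⟨τ, h⟩ := aux_minor f hf
    refine ⟨Finset.univ.image f, ?_, ?_⟩
    · simp [Finset.mem_powersetCard, Finset.card_image_of_injective _ hf]
    · rw [h S, h B]
      rcases Int.units_eq_one_or (Equiv.Perm.sign τ) with h | h <;> simp [h]
  · left
    simp only [Function.Injective, not_forall] at hf
    obtain ⟨a, b, hab, hne⟩ := hf
    rw [Matrix.det_zero_of_column_eq hne (fun k => by simp [hab]), zero_mul]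

theorem aux_nonneg {K M : ℕ} (S B : Matrix (Fin K) (Fin M) ℝ) (z : Fin M → ℝ)
    (hz : ∀ m, 0 < z m) (c : ℝ)
    (hdet : (S * B.transpose).det ≠ 0)
    (h : ∀ f : Fin K → Fin M, 0 ≤ c * ((S.submatrix id f).det * (B.submatrix id f).det))
    (hc : c ≠ 0) :
    ((S * Matrix.diagonal z) * B.transpose).det ≠ 0 := by
  classical
  have hK : (Nat.factorial K : ℝ) ≠ 0 := by positivity
  have key : ∀ f : Fin K → Fin M, ((S * Matrix.diagonal z).submatrix id f).det =
      (∏ i, z (f i)) * (S.submatrix id f).det := by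
    intro f
    rw [← Matrix.det_mul_row]
    congr 1
    ext i j
    simp [Matrix.mul_diagonal, mul_comm]
  intro h0
  have e1 := aux_cb (S * Matrix.diagonal z) B
  rw [h0, mul_zero] at e1
  have e2 : ∑ f : Fin K → Fin M, (∏ i, z (f i)) *
      (c * ((S.submatrix id f).det * (B.submatrix id f).det)) = 0 := by
    have : (0:ℝ) = c * 0 := by simp
    rw [this, e1, Finset.mul_sum]
    refine Finset.sum_congr rfl fun f _ => ?_
    rw [key]; ring
  have hp : ∀ f : Fin K → Fin M, 0 < ∏ i, z (f i) :=
    fun f => Finset.prod_pos fun i _ => hz _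
  rw [Finset.sum_eq_zero_iff_of_nonneg
    (fun f _ => mul_nonneg (hp f).le (h f))] at e2
  have e3 := aux_cb S B
  rw [Finset.sum_eq_zero] at e3
  · exact (mul_ne_zero hK hdet) e3
  · intro f hf
    have := e2 f hf
    simpa [(hp f).ne', hc] using this

theorem aux_pos {K M : ℕ} (S B : Matrix (Fin K) (Fin M) ℝ)
    (hS : ∀ q m, 0 ≤ S q m) (hSrow : ∀ q, ∑ m, S q m = 1) (x : Fin K → ℝ) (q : Fin K) :
    0 < ∑ m, S q m * zeta B x m := by
  have hz : ∀ m, 0 < zeta B x m := fun m => Real.exp_pos _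
  have hnn : ∀ m ∈ Finset.univ, 0 ≤ S q m * zeta B x m :=
    fun m _ => mul_nonneg (hS q m) (hz m).le
  refine lt_of_le_of_ne (Finset.sum_nonneg hnn) fun h => ?_
  have h1 := (Finset.sum_eq_zero_iff_of_nonneg hnn).1 h.symm
  have h2 := hSrow q
  rw [Finset.sum_eq_zero] at h2
  · exact zero_ne_one h2
  · intro m hm
    simpa [(hz m).ne'] using h1 m hm

theorem aux_deriv {K M : ℕ} (S B : Matrix (Fin K) (Fin M) ℝ)
    (hS : ∀ q m, 0 ≤ S q m) (hSrow : ∀ q, ∑ m, S q m = 1) (x : Fin K → ℝ) :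
    HasFDerivAt (Fmap S B) (LinearMap.toContinuousLinearMap (Matrix.toLin'
      (Matrix.diagonal (fun q => -(∑ m, S q m * zeta B x m)⁻¹) *
        ((S * Matrix.diagonal (zeta B x)) * B.transpose)))) x := by
  rw [hasFDerivAt_pi']
  intro q
  have hlin : ∀ m, HasFDerivAt (fun y : Fin K → ℝ => -(∑ k, B k m * y k))
      (-(∑ k, B k m • (ContinuousLinearMap.proj k : (Fin K → ℝ) →L[ℝ] ℝ))) x := by
    intro m
    refine HasFDerivAt.neg ?_
    refine HasFDerivAt.fun_sum fun k _ => ?_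
    exact (ContinuousLinearMap.proj (R := ℝ) (φ := fun _ : Fin K => ℝ) k).hasFDerivAt.const_mul (B k m)
  have hsum := HasFDerivAt.fun_sum (u := Finset.univ)
    fun m _ => ((hlin m).exp.const_mul (S q m))
  have hlog := hsum.log (aux_pos S B hS hSrow x q).ne'
  refine hlog.congr_fderiv ?_
  ext v
  simp only [ContinuousLinearMap.comp_apply, ContinuousLinearMap.proj_apply,
    LinearMap.coe_toContinuousLinearMap', Matrix.toLin'_apply, ContinuousLinearMap.smul_apply,
    ContinuousLinearMap.sum_apply, ContinuousLinearMap.neg_apply, smul_eq_mul,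
    ← Matrix.mulVec_mulVec, Matrix.mulVec_diagonal]
  simp only [Matrix.mulVec, dotProduct, Matrix.transpose_apply, Matrix.diagonal_apply,
    ite_mul, zero_mul, Finset.sum_ite_eq, Finset.mem_univ, if_true, zeta,
    neg_mul, mul_neg, Finset.sum_neg_distrib]

theorem aux_contDiff {K M : ℕ} (S B : Matrix (Fin K) (Fin M) ℝ)
    (hS : ∀ q m, 0 ≤ S q m) (hSrow : ∀ q, ∑ m, S q m = 1) :
    ContDiff ℝ 1 (Fmap S B) := by
  rw [contDiff_pi]
  intro q
  refine ContDiff.log ?_ fun x => (aux_pos S B hS hSrow x q).ne'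
  unfold zeta
  fun_prop

/-- Under Assumption (A), if `det(S Bᵀ) ≠ 0` and the products of the
full-size minors of `S` and `B` all have the same sign (all nonnegative or all
nonpositive), then `F` is a local homeomorphism on `ℝ^Q`; in particular its Jacobian
determinant never vanishes. -/
theorem Fmap_isLocalHomeomorph (K M : ℕ) (hK : 1 ≤ K) (hMK : K ≤ M)
    (S B : Matrix (Fin K) (Fin M) ℝ)
    (hS : ∀ q m, 0 ≤ S q m) (hB : ∀ k m, 0 < B k m)
    (hScol : ∀ m, ∃ q, S q m ≠ 0)
    (hSrow : ∀ q, ∑ m, S q m = 1)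
    (hdet : (S * B.transpose).det ≠ 0)
    (hsign :
      (∀ β ∈ Finset.powersetCard K (Finset.univ : Finset (Fin M)),
        0 ≤ minor S Finset.univ β * minor B Finset.univ β) ∨
      (∀ β ∈ Finset.powersetCard K (Finset.univ : Finset (Fin M)),
        minor S Finset.univ β * minor B Finset.univ β ≤ 0)) :
    IsLocalHomeomorph (Fmap S B) ∧
      ∀ x : Fin K → ℝ, (jacobian (Fmap S B) x).det ≠ 0 := by
  classical
  have hz : ∀ x m, 0 < zeta B x m := fun x m => Real.exp_pos _
  have hD : ∀ x, ((S * Matrix.diagonal (zeta B x)) * B.transpose).det ≠ 0 := by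
    intro x
    rcases hsign with h | h
    · refine aux_nonneg S B _ (hz x) 1 hdet (fun f => ?_) one_ne_zero
      rcases aux_prod S B f with h0 | ⟨β, hβ, h0⟩
      · simp [h0]
      · rw [h0, one_mul]; exact h β hβ
    · refine aux_nonneg S B _ (hz x) (-1) hdet (fun f => ?_) (by norm_num)
      rcases aux_prod S B f with h0 | ⟨β, hβ, h0⟩
      · simp [h0]
      · rw [h0]; linarith [h β hβ]
  have hJ : ∀ x, (jacobian (Fmap S B) x).det ≠ 0 := by
    intro x
    rw [jacobian, (aux_deriv S B hS hSrow x).fderiv, LinearMap.coe_toContinuousLinearMap,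
      LinearMap.toMatrix'_toLin', Matrix.det_mul, Matrix.det_diagonal]
    refine mul_ne_zero (Finset.prod_ne_zero_iff.2 fun q _ => ?_) (hD x)
    exact neg_ne_zero.2 (inv_ne_zero (aux_pos S B hS hSrow x q).ne')
  refine ⟨?_, hJ⟩
  refine IsLocalHomeomorph.mk _ fun x => ?_
  have hdet' : (fderiv ℝ (Fmap S B) x).det ≠ 0 := by
    have := hJ x
    rw [jacobian, LinearMap.det_toMatrix'] at this
    exact this
  have hcd := (aux_contDiff S B hS hSrow).contDiffAt (x := x)
  have hfd : HasFDerivAt (Fmap S B)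
      ((ContinuousLinearMap.toContinuousLinearEquivOfDetNeZero _ hdet' :
        (Fin K → ℝ) ≃L[ℝ] (Fin K → ℝ)) : (Fin K → ℝ) →L[ℝ] (Fin K → ℝ)) x := by
    rw [ContinuousLinearMap.coe_toContinuousLinearEquivOfDetNeZero]
    exact (hcd.differentiableAt one_ne_zero).hasFDerivAt
  exact ⟨hcd.toOpenPartialHomeomorph _ hfd one_ne_zero,
    hcd.mem_toOpenPartialHomeomorph_source hfd one_ne_zero, fun _ _ => rfl⟩
end

section
/- Let Q = K = 2 and assume Assumption (A). Suppose det(S Bᵀ) ≠ 0 and the family of products {det(S[⟨2⟩,β]) · det(B[⟨2⟩,β]) : β ⊆ {1,…,M}, #β = 2} is either all nonnegative or all nonpositive. Suppose furthermore that for each ordered pair (k,l) ∈ {(1,2),(2,1)} there exists q = q(k,l) ∈ {1,2} such that s^{[q]}_m = 0 for every m ∈ 𝓜(k,l), where 𝓜(k,l) := {m : b_{km}/b_{lm} = max_{m'} b_{km'}/b_{lm'}}. Then F is a C¹-diffeomorphism of ℝ² onto ℝ²: F is a continuously differentiable bijection of ℝ² onto ℝ² whose inverse is continuously differentiable. -/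
open scoped BigOperators

lemma det_two_cast {N : ℕ} (hN : N = 2) (A : Matrix (Fin N) (Fin N) ℝ) :
    A.det = A ⟨0, by omega⟩ ⟨0, by omega⟩ * A ⟨1, by omega⟩ ⟨1, by omega⟩
      - A ⟨0, by omega⟩ ⟨1, by omega⟩ * A ⟨1, by omega⟩ ⟨0, by omega⟩ := by
  subst hN
  exact Matrix.det_fin_two A

lemma minor_pair {M : ℕ} (A : Matrix (Fin 2) (Fin M) ℝ) (m n : Fin M) (h : m < n) :
    minor A Finset.univ {m, n} = A 0 m * A 1 n - A 0 n * A 1 m := by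
  have hc : ({m, n} : Finset (Fin M)).card = (Finset.univ : Finset (Fin 2)).card := by
    rw [Finset.card_pair h.ne]; rfl
  unfold minor
  rw [dif_pos hc]
  have hu : (Finset.univ : Finset (Fin 2)).card = 2 := rfl
  rw [det_two_cast hu]
  have key : ∀ (a b : Fin (Finset.univ : Finset (Fin 2)).card), a < b →
      (((Finset.univ : Finset (Fin 2)).orderIsoOfFin rfl a : Fin 2) = 0 ∧
      ((Finset.univ : Finset (Fin 2)).orderIsoOfFin rfl b : Fin 2) = 1) ∧
      ((({m, n} : Finset (Fin M)).orderIsoOfFin hc a : Fin M) = m ∧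
      (({m, n} : Finset (Fin M)).orderIsoOfFin hc b : Fin M) = n) := by
    intro a b hab
    constructor
    · have h1 : ((Finset.univ : Finset (Fin 2)).orderIsoOfFin rfl a : Fin 2) <
        ((Finset.univ : Finset (Fin 2)).orderIsoOfFin rfl b : Fin 2) :=
        ((Finset.univ : Finset (Fin 2)).orderIsoOfFin rfl).strictMono hab
      generalize ((Finset.univ : Finset (Fin 2)).orderIsoOfFin rfl a : Fin 2) = u at *
      generalize ((Finset.univ : Finset (Fin 2)).orderIsoOfFin rfl b : Fin 2) = v at *
      omega
    · have h1 : (({m, n} : Finset (Fin M)).orderIsoOfFin hc a : Fin M) <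
        (({m, n} : Finset (Fin M)).orderIsoOfFin hc b : Fin M) :=
        (({m, n} : Finset (Fin M)).orderIsoOfFin hc).strictMono hab
      have h2 := (({m, n} : Finset (Fin M)).orderIsoOfFin hc a).2
      have h3 := (({m, n} : Finset (Fin M)).orderIsoOfFin hc b).2
      rw [Finset.mem_insert, Finset.mem_singleton] at h2 h3
      rcases h2 with h2 | h2 <;> rcases h3 with h3 | h3
      · rw [h2, h3] at h1; exact absurd h1 (lt_irrefl _)
      · exact ⟨h2, h3⟩
      · rw [h2, h3] at h1; exact absurd h1 h.asymm
      · rw [h2, h3] at h1; exact absurd h1 (lt_irrefl _)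
  obtain ⟨⟨e1, e2⟩, e3, e4⟩ := key ⟨0, by omega⟩ ⟨1, by omega⟩ (Fin.mk_lt_mk.2 Nat.zero_lt_one)
  simp only [Matrix.of_apply]
  rw [e1, e2, e3, e4]

/-- product of the minors -/
noncomputable def PP {M : ℕ} (S B : Matrix (Fin 2) (Fin M) ℝ) (m n : Fin M) : ℝ :=
  (S 0 m * S 1 n - S 0 n * S 1 m) * (B 0 m * B 1 n - B 0 n * B 1 m)

lemma det_lam {M : ℕ} (S B : Matrix (Fin 2) (Fin M) ℝ) (l : Fin M → ℝ) :
    2 * ((∑ m, S 0 m * l m * B 0 m) * (∑ m, S 1 m * l m * B 1 m)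
      - (∑ m, S 0 m * l m * B 1 m) * (∑ m, S 1 m * l m * B 0 m))
    = ∑ m, ∑ n, l m * l n * PP S B m n := by
  have e1 : (∑ m, S 0 m * l m * B 0 m) * (∑ m, S 1 m * l m * B 1 m)
      - (∑ m, S 0 m * l m * B 1 m) * (∑ m, S 1 m * l m * B 0 m)
      = ∑ m, ∑ n, l m * l n * (S 0 m * S 1 n * (B 0 m * B 1 n - B 0 n * B 1 m)) := by
    rw [Finset.sum_mul_sum, Finset.sum_mul_sum, ← Finset.sum_sub_distrib]
    refine Finset.sum_congr rfl fun m _ => ?_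
    rw [← Finset.sum_sub_distrib]
    refine Finset.sum_congr rfl fun n _ => ?_
    ring
  rw [two_mul]
  nth_rewrite 2 [e1]
  rw [Finset.sum_comm, e1, ← Finset.sum_add_distrib]
  refine Finset.sum_congr rfl fun m _ => ?_
  rw [← Finset.sum_add_distrib]
  refine Finset.sum_congr rfl fun n _ => ?_
  unfold PP; ring

lemma PP_sign {M : ℕ} (S B : Matrix (Fin 2) (Fin M) ℝ)
    (hsign :
      (∀ β ∈ Finset.powersetCard 2 (Finset.univ : Finset (Fin M)),
        0 ≤ minor S Finset.univ β * minor B Finset.univ β) ∨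
      (∀ β ∈ Finset.powersetCard 2 (Finset.univ : Finset (Fin M)),
        minor S Finset.univ β * minor B Finset.univ β ≤ 0)) :
    (∀ m n, 0 ≤ PP S B m n) ∨ (∀ m n, PP S B m n ≤ 0) := by
  have hmem : ∀ m n : Fin M, m < n →
      ({m, n} : Finset (Fin M)) ∈ Finset.powersetCard 2 (Finset.univ : Finset (Fin M)) := by
    intro m n h
    rw [Finset.mem_powersetCard]
    exact ⟨Finset.subset_univ _, Finset.card_pair h.ne⟩
  have hsym : ∀ m n, PP S B m n = PP S B n m := by intro m n; unfold PP; ring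
  have hz : ∀ m, PP S B m m = 0 := by intro m; unfold PP; ring
  have hlt : ∀ m n, m < n → minor S Finset.univ {m, n} * minor B Finset.univ {m, n} = PP S B m n := by
    intro m n h
    rw [minor_pair S m n h, minor_pair B m n h]; rfl
  rcases hsign with h | h
  · left
    intro m n
    rcases lt_trichotomy m n with hh | hh | hh
    · rw [← hlt m n hh]; exact h _ (hmem m n hh)
    · rw [hh, hz]
    · rw [hsym, ← hlt n m hh]; exact h _ (hmem n m hh)
  · right
    intro m n
    rcases lt_trichotomy m n with hh | hh | hh
    · rw [← hlt m n hh]; exact h _ (hmem m n hh)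
    · rw [hh, hz]
    · rw [hsym, ← hlt n m hh]; exact h _ (hmem n m hh)

lemma sum_ne {M : ℕ} (P : Fin M → Fin M → ℝ) (hP : ∀ m n, 0 ≤ P m n) (l : Fin M → ℝ)
    (hl : ∀ m, 0 < l m) (h : ∑ m, ∑ n, l m * l n * P m n = 0) : ∀ m n, P m n = 0 := by
  have hnn : ∀ m n, 0 ≤ l m * l n * P m n := fun m n =>
    mul_nonneg (mul_pos (hl m) (hl n)).le (hP m n)
  intro m n
  have h1 := (Finset.sum_eq_zero_iff_of_nonneg
    (fun m _ => Finset.sum_nonneg fun n _ => hnn m n)).1 h m (Finset.mem_univ _)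
  have h2 := (Finset.sum_eq_zero_iff_of_nonneg (fun n _ => hnn m n)).1 h1 n (Finset.mem_univ _)
  exact (mul_eq_zero.1 h2).resolve_left (mul_pos (hl m) (hl n)).ne'

lemma kernel_zero {M : ℕ} (S B : Matrix (Fin 2) (Fin M) ℝ)
    (hdet : (S * B.transpose).det ≠ 0)
    (hsign : (∀ m n, 0 ≤ PP S B m n) ∨ (∀ m n, PP S B m n ≤ 0))
    (l : Fin M → ℝ) (hl : ∀ m, 0 < l m) (v : Fin 2 → ℝ)
    (hv : ∀ q, ∑ m, S q m * (l m * ∑ k, B k m * v k) = 0) : v = 0 := by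
  have hd : (∑ m, S 0 m * l m * B 0 m) * (∑ m, S 1 m * l m * B 1 m)
      - (∑ m, S 0 m * l m * B 1 m) * (∑ m, S 1 m * l m * B 0 m) ≠ 0 := by
    intro h0
    have h1 := det_lam S B l
    rw [h0, mul_zero] at h1
    have hall : ∀ m n, PP S B m n = 0 := by
      rcases hsign with h | h
      · exact sum_ne _ h l hl h1.symm
      · intro m n
        have := sum_ne (fun m n => - PP S B m n) (fun m n => by linarith [h m n]) l hl
          (by simp only [mul_neg, Finset.sum_neg_distrib, ← h1, neg_zero]) m n
        simpa using this
    have h2 := det_lam S B (fun _ => 1)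
    apply hdet
    rw [Matrix.det_fin_two]
    simp only [Matrix.mul_apply, Matrix.transpose_apply]
    simp only [hall, mul_zero, Finset.sum_const_zero, mul_one] at h2
    linarith
  have e : ∀ q, (∑ m, S q m * l m * B 0 m) * v 0 + (∑ m, S q m * l m * B 1 m) * v 1 = 0 := by
    intro q
    rw [← hv q, Finset.sum_mul, Finset.sum_mul, ← Finset.sum_add_distrib]
    refine Finset.sum_congr rfl fun m _ => ?_
    rw [Fin.sum_univ_two]; ring
  have e0 := e 0
  have e1 := e 1
  funext k
  have : ∀ k, v k = 0 := by
    rw [Fin.forall_fin_two]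
    constructor
    · refine (mul_eq_zero.1 ?_).resolve_left hd
      linear_combination (∑ m, S 1 m * l m * B 1 m) * e0 - (∑ m, S 0 m * l m * B 1 m) * e1
    · refine (mul_eq_zero.1 ?_).resolve_left hd
      linear_combination (∑ m, S 0 m * l m * B 0 m) * e1 - (∑ m, S 1 m * l m * B 0 m) * e0
  exact this k

lemma exp_slope (a b : ℝ) : ∃ l : ℝ, 0 < l ∧ Real.exp (-a) - Real.exp (-b) = l * (b - a) := by
  by_cases h : a = b
  · exact ⟨1, one_pos, by simp [h]⟩
  · refine ⟨(Real.exp (-a) - Real.exp (-b)) / (b - a), ?_, ?_⟩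
    · rcases lt_or_gt_of_ne h with h | h
      · exact div_pos (sub_pos.2 (Real.exp_lt_exp.2 (by linarith))) (by linarith)
      · exact div_pos_of_neg_of_neg (sub_neg.2 (Real.exp_lt_exp.2 (by linarith))) (by linarith)
    · have : b - a ≠ 0 := sub_ne_zero.2 (Ne.symm h)
      field_simp

lemma zeta_pos' {M : ℕ} (B : Matrix (Fin 2) (Fin M) ℝ) (x : Fin 2 → ℝ) (m : Fin M) :
    0 < zeta B x m := Real.exp_pos _

lemma sum_pos' {M : ℕ} (S B : Matrix (Fin 2) (Fin M) ℝ)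
    (hS : ∀ q m, 0 ≤ S q m) (hSrow : ∀ q, ∑ m, S q m = 1) (x : Fin 2 → ℝ) (q : Fin 2) :
    0 < ∑ m, S q m * zeta B x m := by
  have hnn : ∀ m, 0 ≤ S q m * zeta B x m := fun m => mul_nonneg (hS q m) (zeta_pos' B x m).le
  rcases (Finset.sum_nonneg fun m (_ : m ∈ Finset.univ) => hnn m).lt_or_eq with h | h
  · exact h
  · exfalso
    have h1 := (Finset.sum_eq_zero_iff_of_nonneg (fun m _ => hnn m)).1 h.symm
    have : ∑ m, S q m = 0 := Finset.sum_eq_zero fun m hm =>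
      (mul_eq_zero.1 (h1 m hm)).resolve_right (zeta_pos' B x m).ne'
    rw [hSrow q] at this
    exact one_ne_zero this

lemma F_inj {M : ℕ} (S B : Matrix (Fin 2) (Fin M) ℝ)
    (hS : ∀ q m, 0 ≤ S q m) (hSrow : ∀ q, ∑ m, S q m = 1)
    (hdet : (S * B.transpose).det ≠ 0)
    (hsign : (∀ m n, 0 ≤ PP S B m n) ∨ (∀ m n, PP S B m n ≤ 0)) :
    Function.Injective (Fmap S B) := by
  intro x y hxy
  choose l hl he using fun m => exp_slope (∑ k, B k m * x k) (∑ k, B k m * y k)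
  have := kernel_zero S B hdet hsign l hl (y - x) (by
    intro q
    have h1 : ∑ m, S q m * zeta B x m = ∑ m, S q m * zeta B y m :=
      Real.log_injOn_pos (sum_pos' S B hS hSrow x q) (sum_pos' S B hS hSrow y q) (congrFun hxy q)
    rw [← sub_eq_zero, ← Finset.sum_sub_distrib] at h1
    rw [← h1]
    refine Finset.sum_congr rfl fun m _ => ?_
    rw [← mul_sub]
    unfold zeta
    rw [he m, ← Finset.sum_sub_distrib]
    simp only [Pi.sub_apply, mul_sub])
  exact (sub_eq_zero.1 this).symm

lemma F_contDiff {M : ℕ} (S B : Matrix (Fin 2) (Fin M) ℝ)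
    (hS : ∀ q m, 0 ≤ S q m) (hSrow : ∀ q, ∑ m, S q m = 1) :
    ContDiff ℝ 1 (Fmap S B) := by
  rw [contDiff_pi]
  intro q
  unfold Fmap
  refine ContDiff.log ?_ (fun x => (sum_pos' S B hS hSrow x q).ne')
  unfold zeta
  fun_prop

lemma F_deriv {M : ℕ} (S B : Matrix (Fin 2) (Fin M) ℝ)
    (hS : ∀ q m, 0 ≤ S q m) (hSrow : ∀ q, ∑ m, S q m = 1) (x v : Fin 2 → ℝ) (q : Fin 2) :
    fderiv ℝ (Fmap S B) x v q = 
      -(∑ m, S q m * zeta B x m)⁻¹ * ∑ m, S q m * (zeta B x m * ∑ k, B k m * v k) := by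
  have hd : HasFDerivAt (Fmap S B) (fderiv ℝ (Fmap S B) x) x :=
    ((F_contDiff S B hS hSrow).differentiable (by norm_num) x).hasFDerivAt
  have hline : HasDerivAt (fun t : ℝ => x + t • v) v 0 := by
    simpa using ((hasDerivAt_id (0:ℝ)).smul_const v).const_add x
  have h1 : HasDerivAt (fun t : ℝ => Fmap S B (x + t • v)) (fderiv ℝ (Fmap S B) x v) 0 := by
    have hd' : HasFDerivAt (Fmap S B) (fderiv ℝ (Fmap S B) x) (x + (0:ℝ) • v) := by
      simpa using hd
    exact hd'.comp_hasDerivAt (0:ℝ) hline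
  have h2 := (hasDerivAt_pi.1 h1) q
  have h3 : HasDerivAt (fun t : ℝ => ∑ m, S q m * zeta B (x + t • v) m)
      (∑ m, S q m * (zeta B x m * -(∑ k, B k m * v k))) 0 := by
    refine HasDerivAt.fun_sum fun m _ => HasDerivAt.const_mul _ ?_
    have h4 : HasDerivAt (fun t : ℝ => -∑ k, B k m * (x + t • v) k) (-(∑ k, B k m * v k)) 0 := by
      refine HasDerivAt.fun_neg (HasDerivAt.fun_sum fun k _ => HasDerivAt.const_mul _ ?_)
      exact (hasDerivAt_pi.1 hline) k
    have h5 := h4.exp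
    simpa [zeta] using h5
  have h6 := h3.log (by simpa using (sum_pos' S B hS hSrow x q).ne')
  have h7 := h2.unique h6
  rw [h7]
  simp only [zero_smul, add_zero, mul_neg, Finset.sum_neg_distrib]
  rw [div_eq_inv_mul]; ring

lemma upper_bound {M : ℕ} (hM : 2 ≤ M) (S B : Matrix (Fin 2) (Fin M) ℝ)
    (hB : ∀ k m, 0 < B k m)
    (hvanish : ∀ k l : Fin 2, k ≠ l → ∃ q : Fin 2, ∀ m : Fin M,
      (∀ m', B k m' / B l m' ≤ B k m / B l m) → S q m = 0) (R : ℝ) (k l : Fin 2) (hkl : k ≠ l) :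
    ∃ C, ∀ x : Fin 2 → ℝ, (∀ m, -R ≤ B k m * x k + B l m * x l) →
      (∀ q, ∃ m, S q m ≠ 0 ∧ B k m * x k + B l m * x l ≤ R) → x l ≤ C := by
  have : Nonempty (Fin M) := ⟨⟨0, by omega⟩⟩
  obtain ⟨n, hn⟩ := Finite.exists_max (fun m => B k m / B l m)
  obtain ⟨q, hq⟩ := hvanish k l hkl
  obtain ⟨C, hC⟩ := Set.Finite.bddAbove (Set.finite_range
    (fun m => R * (B k n + B k m) / (B k n * B l m - B k m * B l n)))
  refine ⟨C, fun x h1 h2 => ?_⟩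
  obtain ⟨m, hm, hmR⟩ := h2 q
  have hlt : B k m / B l m < B k n / B l n := by
    refine lt_of_le_of_ne (hn m) fun he => hm (hq m fun m' => ?_)
    rw [he]; exact hn m'
  rw [div_lt_div_iff₀ (hB l m) (hB l n)] at hlt
  refine le_trans ?_ (hC ⟨m, rfl⟩)
  simp only
  rw [le_div_iff₀ (by linarith)]
  have := mul_le_mul_of_nonneg_left hmR (hB k n).le
  have := mul_le_mul_of_nonneg_left (h1 n) (hB k m).le
  linarith

lemma F_bound {M : ℕ} (hM : 2 ≤ M) (S B : Matrix (Fin 2) (Fin M) ℝ)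
    (hS : ∀ q m, 0 ≤ S q m) (hB : ∀ k m, 0 < B k m)
    (hScol : ∀ m, ∃ q, S q m ≠ 0) (hSrow : ∀ q, ∑ m, S q m = 1)
    (hvanish : ∀ k l : Fin 2, k ≠ l → ∃ q : Fin 2, ∀ m : Fin M,
      (∀ m', B k m' / B l m' ≤ B k m / B l m) → S q m = 0) (R : ℝ) :
    ∃ C, ∀ x : Fin 2 → ℝ, (∀ q, |Fmap S B x q| ≤ R) → ∀ k, |x k| ≤ C := by
  have : Nonempty (Fin M) := ⟨⟨0, by omega⟩⟩
  -- lower bound constants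
  obtain ⟨R1, hR1⟩ := Set.Finite.bddAbove (Set.finite_range
    (fun p : Fin 2 × Fin M => R - Real.log (S p.1 p.2)))
  have lower : ∀ x : Fin 2 → ℝ, (∀ q, |Fmap S B x q| ≤ R) →
      ∀ m, -R1 ≤ ∑ k, B k m * x k := by
    intro x hx m
    obtain ⟨q, hq⟩ := hScol m
    have hpos : 0 < S q m := lt_of_le_of_ne (hS q m) hq.symm
    have h1 : S q m * zeta B x m ≤ ∑ m, S q m * zeta B x m :=
      Finset.single_le_sum (f := fun m => S q m * zeta B x m)
        (fun m _ => mul_nonneg (hS q m) (zeta_pos' B x m).le) (Finset.mem_univ m)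
    have h2 := Real.log_le_log (mul_pos hpos (zeta_pos' B x m)) h1
    rw [Real.log_mul hpos.ne' (zeta_pos' B x m).ne', zeta, Real.log_exp] at h2
    have h3 := (abs_le.1 (hx q)).2
    unfold Fmap at h3
    have h4 : R - Real.log (S q m) ≤ R1 := hR1 ⟨(q, m), rfl⟩
    linarith
  have upper : ∀ x : Fin 2 → ℝ, (∀ q, |Fmap S B x q| ≤ R) →
      ∀ q, ∃ m, S q m ≠ 0 ∧ ∑ k, B k m * x k ≤ R := by
    intro x hx q
    by_contra! hcon
    have h1 : ∑ m, S q m * zeta B x m < Real.exp (-R) := by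
      have h2 : ∀ m, S q m * zeta B x m ≤ S q m * Real.exp (-R) := by
        intro m
        by_cases h : S q m = 0
        · simp [h]
        · exact mul_le_mul_of_nonneg_left (Real.exp_le_exp.2 (by linarith [hcon m h])) (hS q m)
      obtain ⟨m, hm⟩ : ∃ m, S q m ≠ 0 := by
        by_contra! h
        have := hSrow q
        simp [h] at this
      calc ∑ m, S q m * zeta B x m < ∑ m, S q m * Real.exp (-R) := by
            refine Finset.sum_lt_sum (fun m _ => h2 m) ⟨m, Finset.mem_univ m, ?_⟩
            exact mul_lt_mul_of_pos_left (Real.exp_lt_exp.2 (by linarith [hcon m hm]))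
              (lt_of_le_of_ne (hS q m) hm.symm)
        _ = Real.exp (-R) := by rw [← Finset.sum_mul, hSrow q, one_mul]
    have h3 := Real.log_lt_log (sum_pos' S B hS hSrow x q) h1
    rw [Real.log_exp] at h3
    have h4 := (abs_le.1 (hx q)).1
    unfold Fmap at h4
    linarith
  obtain ⟨C0, hC0⟩ := upper_bound hM S B hB hvanish (max R R1) 1 0 (by decide)
  obtain ⟨C1, hC1⟩ := upper_bound hM S B hB hvanish (max R R1) 0 1 (by decide)
  obtain ⟨m⟩ := (inferInstance : Nonempty (Fin M))
  have b0 := hB 0 m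
  have b1 := hB 1 m
  refine ⟨max (max |C0| |C1|) (max ((R1 + B 1 m * C1) / B 0 m) ((R1 + B 0 m * C0) / B 1 m)),
    fun x hx => ?_⟩
  have lo := lower x hx
  have up := upper x hx
  simp only [Fin.sum_univ_two] at lo up
  have u0 : x 0 ≤ C0 := by
    refine hC0 x (fun m => ?_) (fun q => ?_)
    · linarith [lo m, le_max_right R R1]
    · obtain ⟨m, hm, h⟩ := up q
      exact ⟨m, hm, by linarith [le_max_left R R1]⟩
  have u1 : x 1 ≤ C1 := by
    refine hC1 x (fun m => ?_) (fun q => ?_)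
    · linarith [lo m, le_max_right R R1]
    · obtain ⟨m, hm, h⟩ := up q
      exact ⟨m, hm, by linarith [le_max_left R R1]⟩
  have l0 : -x 0 ≤ (R1 + B 1 m * C1) / B 0 m := by
    rw [le_div_iff₀ b0]
    linarith [lo m, mul_le_mul_of_nonneg_left u1 b1.le]
  have l1 : -x 1 ≤ (R1 + B 0 m * C0) / B 1 m := by
    rw [le_div_iff₀ b1]
    linarith [lo m, mul_le_mul_of_nonneg_left u0 b0.le]
  rw [Fin.forall_fin_two]
  constructor
  · rw [abs_le']
    exact ⟨le_max_of_le_left (le_max_of_le_left (u0.trans (le_abs_self _))),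
      le_max_of_le_right (le_max_of_le_left l0)⟩
  · rw [abs_le']
    exact ⟨le_max_of_le_left (le_max_of_le_right (u1.trans (le_abs_self _))),
      le_max_of_le_right (le_max_of_le_right l1)⟩

/-- In DECT (`Q = K = 2`), under Assumption (A), the determinant and
same-sign minor conditions, and the vanishing condition of `S` on the maximizer sets
`𝓜(k,l)`, the map `F` is a `C¹`-diffeomorphism of `ℝ²` onto `ℝ²`: a continuously
differentiable bijection whose inverse is continuously differentiable. -/
theorem Fmap_diffeomorphism_DECT (M : ℕ) (hM : 2 ≤ M)
    (S B : Matrix (Fin 2) (Fin M) ℝ)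
    (hS : ∀ q m, 0 ≤ S q m) (hB : ∀ k m, 0 < B k m)
    (hScol : ∀ m, ∃ q, S q m ≠ 0)
    (hSrow : ∀ q, ∑ m, S q m = 1)
    (hdet : (S * B.transpose).det ≠ 0)
    (hsign :
      (∀ β ∈ Finset.powersetCard 2 (Finset.univ : Finset (Fin M)),
        0 ≤ minor S Finset.univ β * minor B Finset.univ β) ∨
      (∀ β ∈ Finset.powersetCard 2 (Finset.univ : Finset (Fin M)),
        minor S Finset.univ β * minor B Finset.univ β ≤ 0))
    (hvanish : ∀ k l : Fin 2, k ≠ l → ∃ q : Fin 2, ∀ m : Fin M,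
      (∀ m', B k m' / B l m' ≤ B k m / B l m) → S q m = 0) :
    ContDiff ℝ 1 (Fmap S B) ∧ Function.Bijective (Fmap S B) ∧
      ∃ G : (Fin 2 → ℝ) → (Fin 2 → ℝ), ContDiff ℝ 1 G ∧
        Function.LeftInverse G (Fmap S B) ∧ Function.RightInverse G (Fmap S B) := by
  have hP := PP_sign S B hsign
  have hcd := F_contDiff S B hS hSrow
  have hinj := F_inj S B hS hSrow hdet hP
  have hker : ∀ x, Function.Injective (fderiv ℝ (Fmap S B) x) := by
    intro x
    rw [injective_iff_map_eq_zero]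
    intro v hv
    refine kernel_zero S B hdet hP (zeta B x) (zeta_pos' B x) v fun q => ?_
    have h1 := F_deriv S B hS hSrow x v q
    rw [hv, Pi.zero_apply] at h1
    exact (mul_eq_zero.1 h1.symm).resolve_left
      (neg_ne_zero.2 (inv_ne_zero (sum_pos' S B hS hSrow x q).ne'))
  have hequiv : ∀ x, ∃ e : (Fin 2 → ℝ) ≃L[ℝ] (Fin 2 → ℝ),
      HasStrictFDerivAt (Fmap S B) (e : (Fin 2 → ℝ) →L[ℝ] (Fin 2 → ℝ)) x := by
    intro x
    let e := (LinearEquiv.ofInjectiveEndo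
      (fderiv ℝ (Fmap S B) x : (Fin 2 → ℝ) →ₗ[ℝ] (Fin 2 → ℝ)) (hker x)).toContinuousLinearEquiv
    refine ⟨e, ?_⟩
    have h1 := hcd.contDiffAt.hasStrictFDerivAt (x := x) (by norm_num)
    have h2 : (e : (Fin 2 → ℝ) →L[ℝ] (Fin 2 → ℝ)) = fderiv ℝ (Fmap S B) x := by
      ext v; rfl
    rw [h2]; exact h1
  choose e he using hequiv
  have hopen : IsOpenMap (Fmap S B) := isOpenMap_of_hasStrictFDerivAt_equiv he
  have hproper : IsProperMap (Fmap S B) := by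
    rw [isProperMap_iff_isCompact_preimage]
    refine ⟨hcd.continuous, fun K hK => ?_⟩
    obtain ⟨R, hR⟩ := hK.isBounded.exists_norm_le
    obtain ⟨C, hC⟩ := F_bound hM S B hS hB hScol hSrow hvanish R
    refine Metric.isCompact_of_isClosed_isBounded (hK.isClosed.preimage hcd.continuous) ?_
    refine isBounded_iff_forall_norm_le.2 ⟨max C 0, fun x hx => ?_⟩
    rw [pi_norm_le_iff_of_nonneg (le_max_right _ _)]
    intro k
    exact (hC x (fun q => (norm_le_pi_norm _ q).trans (hR _ hx)) k).trans (le_max_left _ _)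
  have hsurj : Function.Surjective (Fmap S B) := by
    rw [← Set.range_eq_univ]
    exact IsClopen.eq_univ ⟨hproper.isClosedMap.isClosed_range, hopen.isOpen_range⟩
      (Set.range_nonempty _)
  refine ⟨hcd, ⟨hinj, hsurj⟩, ?_⟩
  let E := Equiv.ofBijective (Fmap S B) ⟨hinj, hsurj⟩
  let H : (Fin 2 → ℝ) ≃ₜ (Fin 2 → ℝ) := E.toHomeomorphOfContinuousOpen hcd.continuous hopen
  refine ⟨H.symm, ?_, E.left_inv, E.right_inv⟩
  exact H.contDiff_symm (f₀' := e) (fun x => (he x).hasFDerivAt) hcd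
end

section
/- Assume Assumption (A) and that the family of products {det(S[⟨Q⟩,β]) · det(B[⟨Q⟩,β]) : β ⊆ {1,…,M}, #β = Q} is all nonnegative. Let Ω ⊆ ℝ^Q be a compact set. Then for every x ∈ Ω the Jacobian matrix DF(x) of F satisfies |det(DF(x))| ≥ κ · |det(S Bᵀ)|, where κ := min over β ⊆ {1,…,M} with #β = Q and y ∈ Ω of (∏_{i∈β} ζ_i(y)) / (∏_{q=1}^Q ∑_{m=1}^M s^{[q]}_m ζ_m(y)). -/
open scoped BigOperators

theorem minor_univ_eq {K M : ℕ} (A : Matrix (Fin K) (Fin M) ℝ) (β : Finset (Fin M))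
    (h : β.card = K) :
    minor A Finset.univ β = (Matrix.of fun i j : Fin K => A i (β.orderEmbOfFin h j)).det := by
  have hc : (Finset.univ : Finset (Fin K)).card = K := by simp
  have h' : β.card = (Finset.univ : Finset (Fin K)).card := by rw [h, hc]
  unfold minor
  rw [dif_pos h']
  rw [← Matrix.det_submatrix_equiv_self (finCongr hc)]
  congr 1
  ext i j
  simp only [Matrix.of_apply, Matrix.submatrix_apply]
  have h1 : (((Finset.univ : Finset (Fin K)).orderIsoOfFin rfl i : _) : Fin K)
      = finCongr hc i := by
    have := Finset.orderEmbOfFin_unique (s := (Finset.univ : Finset (Fin K))) rfl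
      (f := fun i => finCongr hc i) (fun _ => Finset.mem_univ _) (fun a b hab => hab)
    exact (congrFun this i).symm
  have h2 : ((β.orderIsoOfFin h' j : _) : Fin M) = β.orderEmbOfFin h (finCongr hc j) := by
    have := Finset.orderEmbOfFin_unique (s := β) h'
      (f := fun j => β.orderEmbOfFin h (finCongr hc j))
      (fun _ => Finset.orderEmbOfFin_mem _ _ _)
      (fun a b hab => (β.orderEmbOfFin h).strictMono hab)
    exact (congrFun this j).symm
  rw [h1, h2]

theorem det_expand {K M : ℕ} (A B : Matrix (Fin K) (Fin M) ℝ) :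
    (A * B.transpose).det = ∑ f : Fin K → Fin M,
      (∏ i, A i (f i)) * (Matrix.of fun i j : Fin K => B j (f i)).det := by
  have h : (A * B.transpose) = fun i => ∑ m, A i m • (fun j => B j m) := by
    ext i j
    simp [Matrix.mul_apply]
  rw [h]
  change Matrix.detRowAlternating.toMultilinearMap _ = _
  rw [MultilinearMap.map_sum]
  refine Finset.sum_congr rfl fun f _ => ?_
  rw [MultilinearMap.map_smul_univ]
  rfl

theorem cauchy_binet_w {K M : ℕ} (S B : Matrix (Fin K) (Fin M) ℝ) (d : Fin M → ℝ) :
    ((Matrix.of fun i m => S i m * d m) * B.transpose).det =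
      ∑ β ∈ Finset.powersetCard K (Finset.univ : Finset (Fin M)),
        (∏ i ∈ β, d i) * (minor S Finset.univ β * minor B Finset.univ β) := by
  rw [det_expand]
  have h0 : ∀ f ∈ (Finset.univ : Finset (Fin K → Fin M)),
      f ∉ (Finset.univ.filter fun f : Fin K → Fin M => Function.Injective f) →
      (∏ i, (Matrix.of fun i m => S i m * d m) i (f i)) *
        (Matrix.of fun i j : Fin K => B j (f i)).det = 0 := by
    intro f _ hf
    have hf2 : ¬ Function.Injective f := fun hi =>
      hf (Finset.mem_filter.2 ⟨Finset.mem_univ _, hi⟩)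
    obtain ⟨a, b, hab, hne⟩ := Function.not_injective_iff.1 hf2
    rw [Matrix.det_zero_of_row_eq hne, mul_zero]
    ext j
    simp [hab]
  rw [← Finset.sum_subset (Finset.subset_univ _) h0]
  rw [← Finset.sum_fiberwise_of_maps_to (s := Finset.univ.filter fun f : Fin K → Fin M =>
      Function.Injective f) (t := Finset.powersetCard K (Finset.univ : Finset (Fin M)))
      (g := fun f => Finset.univ.image f)]
  swap
  · intro f hf
    simp only [Finset.mem_filter, Finset.mem_univ, true_and] at hf
    simp [Finset.mem_powersetCard, Finset.card_image_of_injective _ hf]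
  refine Finset.sum_congr rfl fun β hβ => ?_
  have h : β.card = K := (Finset.mem_powersetCard.1 hβ).2
  rw [minor_univ_eq S β h, minor_univ_eq B β h]
  set e := β.orderEmbOfFin h with he
  have himg : Finset.univ.image e = β := by
    ext m
    have := Finset.range_orderEmbOfFin β h
    have := Set.ext_iff.1 this m
    refine Iff.trans ?_ (this.trans Finset.mem_coe)
    simp only [Finset.mem_image, Finset.mem_univ, true_and, Set.mem_range, he]
  trans ∑ σ : Equiv.Perm (Fin K), (∏ i, (S i (e (σ i)) * d (e (σ i)))) *
        (Matrix.of fun i j : Fin K => B j (e (σ i))).det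
  · symm
    refine Finset.sum_bij (fun σ _ => fun i => e (σ i)) ?_ ?_ ?_ ?_
    · intro σ _
      simp only [Finset.mem_filter, Finset.mem_univ, true_and]
      refine ⟨e.injective.comp σ.injective, ?_⟩
      rw [← himg]
      ext m
      simp only [Finset.mem_image, Finset.mem_univ, true_and]
      exact ⟨fun ⟨a, ha⟩ => ⟨σ a, ha⟩, fun ⟨a, ha⟩ => ⟨σ.symm a, by simpa using ha⟩⟩
    · intro σ _ τ _ hh
      ext i
      have := e.injective (congrFun hh i)
      rw [this]
    · intro f hf
      simp only [Finset.mem_filter, Finset.mem_univ, true_and] at hf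
      obtain ⟨hinj, him⟩ := hf
      have : ∀ i, ∃ j, e j = f i := by
        intro i
        have : f i ∈ Finset.univ.image e := by
          rw [himg, ← him]; exact Finset.mem_image_of_mem _ (Finset.mem_univ _)
        simpa using this
      choose g hg using this
      have hgi : Function.Injective g := by
        intro a b hab
        apply hinj
        rw [← hg a, ← hg b, hab]
      exact ⟨Equiv.ofBijective g (Finite.injective_iff_bijective.1 hgi), Finset.mem_univ _,
        funext fun i => hg i⟩
    · intro σ _
      rfl
  have hd : ∀ σ : Equiv.Perm (Fin K), ∏ i, d (e (σ i)) = ∏ i ∈ β, d i := by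
    intro σ
    rw [Equiv.prod_comp σ (fun i => d (e i)), ← himg, Finset.prod_image]
    exact fun a _ b _ hab => e.injective hab
  have hdet : ∀ σ : Equiv.Perm (Fin K), (Matrix.of fun i j : Fin K => B j (e (σ i))).det
      = ((Equiv.Perm.sign σ : ℤ) : ℝ) * (Matrix.of fun i j : Fin K => B i (e j)).det := by
    intro σ
    rw [← Matrix.det_transpose (Matrix.of fun i j : Fin K => B i (e j)),
      ← Matrix.det_permute]
    rfl
  have hS : (Matrix.of fun i j : Fin K => S i (e j)).det =
      ∑ σ : Equiv.Perm (Fin K), ((Equiv.Perm.sign σ : ℤ) : ℝ) * ∏ i, S i (e (σ i)) := by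
    rw [← Matrix.det_transpose, Matrix.det_apply']
    rfl
  rw [hS, Finset.sum_mul, Finset.mul_sum]
  refine Finset.sum_congr rfl fun σ _ => ?_
  rw [Finset.prod_mul_distrib, hd, hdet]
  ring

theorem jac_eq {K M : ℕ} (S B : Matrix (Fin K) (Fin M) ℝ) (x : Fin K → ℝ)
    (hpos : ∀ q, 0 < ∑ m, S q m * zeta B x m) :
    jacobian (Fmap S B) x = Matrix.of fun q k => (-(∑ m, S q m * zeta B x m)⁻¹) *
      ((Matrix.of fun i m => S i m * zeta B x m) * B.transpose) q k := by
  have hz : ∀ m, HasFDerivAt (fun y => zeta B y m)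
      (zeta B x m • (-(∑ k, B k m • ContinuousLinearMap.proj (R := ℝ) (φ := fun _ : Fin K => ℝ) k)))
      x := by
    intro m
    unfold zeta
    refine HasFDerivAt.exp (f := fun y : Fin K → ℝ => -(∑ k, B k m * y k)) ?_
    refine HasFDerivAt.neg ?_
    refine HasFDerivAt.fun_sum fun k _ => ?_
    exact (hasFDerivAt_apply k x).const_mul (B k m)
  have hF : HasFDerivAt (Fmap S B) (ContinuousLinearMap.pi fun q =>
      (∑ m, S q m * zeta B x m)⁻¹ • ∑ m, S q m • (zeta B x m •
        (-(∑ k, B k m • ContinuousLinearMap.proj (R := ℝ) (φ := fun _ : Fin K => ℝ) k)))) x := by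
    rw [hasFDerivAt_pi]
    intro q
    refine HasFDerivAt.log (f := fun y => ∑ m, S q m * zeta B y m) ?_ (hpos q).ne'
    exact HasFDerivAt.fun_sum fun m _ => (hz m).const_mul (S q m)
  unfold jacobian
  rw [hF.fderiv]
  ext q k
  simp [LinearMap.toMatrix'_apply, Matrix.mul_apply, Pi.single_apply, Finset.mul_sum]
  refine Finset.sum_congr rfl fun m _ => ?_
  ring

/-- Under Assumption (A) and nonnegativity of the full-size minor
products of `S` and `B`, on a compact set `Ω` the Jacobian determinant of `F`
satisfies `|det(DF(x))| ≥ κ |det(S Bᵀ)|`, where `κ` is the minimum over `β` with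
`#β = Q` and `y ∈ Ω` of `(∏_{i∈β} ζ_i(y)) / ∏_q ∑_m s^{[q]}_m ζ_m(y)`. -/
theorem jacobian_det_lower_bound (K M : ℕ) (hK : 1 ≤ K) (hMK : K ≤ M)
    (S B : Matrix (Fin K) (Fin M) ℝ)
    (hS : ∀ q m, 0 ≤ S q m) (hB : ∀ k m, 0 < B k m)
    (hScol : ∀ m, ∃ q, S q m ≠ 0)
    (hSrow : ∀ q, ∑ m, S q m = 1)
    (hsign : ∀ β ∈ Finset.powersetCard K (Finset.univ : Finset (Fin M)),
      0 ≤ minor S Finset.univ β * minor B Finset.univ β)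
    (Ω : Set (Fin K → ℝ)) (hΩ : IsCompact Ω) :
    ∀ x ∈ Ω,
      sInf ((fun p : Finset (Fin M) × (Fin K → ℝ) =>
            (∏ i ∈ p.1, zeta B p.2 i) / ∏ q, ∑ m, S q m * zeta B p.2 m) ''
          {p | p.1.card = K ∧ p.2 ∈ Ω}) *
        |(S * B.transpose).det| ≤ |(jacobian (Fmap S B) x).det| := by
  intro x hx
  set c : ℝ := sInf _ with hc
  have hz : ∀ y m, 0 < zeta B y m := fun y m => Real.exp_pos _
  have hpos : ∀ y q, 0 < ∑ m, S q m * zeta B y m := by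
    intro y q
    have hnn : ∀ m ∈ Finset.univ, 0 ≤ S q m * zeta B y m :=
      fun m _ => mul_nonneg (hS q m) (hz y m).le
    refine lt_of_le_of_ne (Finset.sum_nonneg hnn) fun h0 => ?_
    have h1 := (Finset.sum_eq_zero_iff_of_nonneg hnn).1 h0.symm
    have h2 : ∑ m, S q m = 0 := Finset.sum_eq_zero fun m hm =>
      (mul_eq_zero.1 (h1 m hm)).resolve_right (hz y m).ne'
    rw [hSrow q] at h2
    exact one_ne_zero h2
  have hP : 0 < ∏ q, ∑ m, S q m * zeta B x m := Finset.prod_pos fun q _ => hpos x q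
  have hcle : ∀ β ∈ Finset.powersetCard K (Finset.univ : Finset (Fin M)),
      c ≤ (∏ i ∈ β, zeta B x i) / ∏ q, ∑ m, S q m * zeta B x m := by
    intro β hβ
    refine csInf_le ⟨0, ?_⟩ ⟨(β, x), ⟨(Finset.mem_powersetCard.1 hβ).2, hx⟩, rfl⟩
    rintro _ ⟨p, _, rfl⟩
    exact div_nonneg (Finset.prod_nonneg fun i _ => (hz _ i).le)
      (Finset.prod_nonneg fun q _ => (hpos _ q).le)
  have h1 : (S * B.transpose).det = ∑ β ∈ Finset.powersetCard K (Finset.univ : Finset (Fin M)),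
      (minor S Finset.univ β * minor B Finset.univ β) := by
    have := cauchy_binet_w S B (fun _ => 1)
    simp only [mul_one, Finset.prod_const_one, one_mul] at this
    exact this
  have h2 := cauchy_binet_w S B (zeta B x)
  rw [jac_eq S B x (hpos x), Matrix.det_mul_column, h2, h1, abs_mul, Finset.abs_prod]
  simp only [abs_neg, abs_inv, abs_of_pos (hpos x _)]
  rw [abs_of_nonneg (Finset.sum_nonneg hsign), abs_of_nonneg (Finset.sum_nonneg fun β hβ =>
    mul_nonneg (Finset.prod_nonneg fun i _ => (hz x i).le) (hsign β hβ)),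
    Finset.mul_sum, Finset.mul_sum, Finset.prod_inv_distrib]
  refine Finset.sum_le_sum fun β hβ => ?_
  refine (mul_le_mul_of_nonneg_right (hcle β hβ) (hsign β hβ)).trans (le_of_eq ?_)
  rw [div_eq_mul_inv]
  ring
end
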